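/- If m is a positive integer, then for every positive integer n > 14.4/(1.5^(1/m) − 1)^m there exist a positive integer a and a prime number s such that n < a^m < 3n/2 < s < 2n (equivalently, 2n < 2a^m < 3n < 2s < 4n). -/

import Mathlib

open ArithmeticFunction Finset in
lemma aux_log_factorial (K N : ℕ) (h : N ≤ K) :
    Real.log (N.factorial : ℝ) = ∑ d ∈ Ioc 0 K, vonMangoldt d * ((N / d : ℕ) : ℝ) := by
  induction N with
  | zero => simp
  | succ N ih =>
    have ih := ih (by omega)
    rw [Nat.factorial_succ, Nat.cast_mul, Real.log_mul (by positivity) (by positivity), ih,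
      ← vonMangoldt_sum]
    have h1 : (N + 1).divisors = (Ioc 0 K).filter (fun d => d ∣ N + 1) := by
      ext d
      simp only [Nat.mem_divisors, mem_filter, mem_Ioc]
      constructor
      · rintro ⟨hd, _⟩
        exact ⟨⟨Nat.pos_of_dvd_of_pos hd (by omega),
          (Nat.le_of_dvd (by omega) hd).trans h⟩, hd⟩
      · rintro ⟨_, hd⟩
        exact ⟨hd, by omega⟩
    rw [h1, sum_filter, ← sum_add_distrib]
    refine sum_congr rfl fun d _ => ?_
    rw [Nat.succ_div]
    split_ifs <;> push_cast <;> ring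

/-- The logarithm of the Chebyshev quotient. -/
noncomputable def auxC (M : ℕ) : ℝ :=
  Real.log ((30 * M).factorial : ℝ) - Real.log ((15 * M).factorial : ℝ)
    - Real.log ((10 * M).factorial : ℝ) - Real.log ((6 * M).factorial : ℝ)
    + Real.log (M.factorial : ℝ)

open ArithmeticFunction Finset in
lemma auxC_eq (M : ℕ) : auxC M = ∑ d ∈ Ioc 0 (30 * M), vonMangoldt d *
    (((30 * M / d : ℕ) : ℝ) - ((30 * M / d / 2 : ℕ) : ℝ) - ((30 * M / d / 3 : ℕ) : ℝ)
      - ((30 * M / d / 5 : ℕ) : ℝ) + ((30 * M / d / 30 : ℕ) : ℝ)) := by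
  unfold auxC
  rw [aux_log_factorial (30 * M) (30 * M) le_rfl, aux_log_factorial (30 * M) (15 * M) (by omega),
    aux_log_factorial (30 * M) (10 * M) (by omega), aux_log_factorial (30 * M) (6 * M) (by omega),
    aux_log_factorial (30 * M) M (by omega), ← sum_sub_distrib, ← sum_sub_distrib,
    ← sum_sub_distrib, ← sum_add_distrib]
  refine sum_congr rfl fun d _ => ?_
  rw [Nat.div_div_eq_div_mul, Nat.div_div_eq_div_mul, Nat.div_div_eq_div_mul,
    Nat.div_div_eq_div_mul, mul_comm d 2, mul_comm d 3, mul_comm d 5, mul_comm d 30,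
    ← Nat.div_div_eq_div_mul, ← Nat.div_div_eq_div_mul, ← Nat.div_div_eq_div_mul,
    ← Nat.div_div_eq_div_mul, show 30 * M / 2 = 15 * M by omega,
    show 30 * M / 3 = 10 * M by omega, show 30 * M / 5 = 6 * M by omega,
    show 30 * M / 30 = M by omega]
  ring

lemma aux_E_le (k : ℕ) : (k : ℝ) - ((k / 2 : ℕ) : ℝ) - ((k / 3 : ℕ) : ℝ)
    - ((k / 5 : ℕ) : ℝ) + ((k / 30 : ℕ) : ℝ) ≤ 1 := by
  have : k + k / 30 ≤ 1 + k / 2 + k / 3 + k / 5 := by omega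
  have : ((k + k / 30 : ℕ) : ℝ) ≤ ((1 + k / 2 + k / 3 + k / 5 : ℕ) : ℝ) := by exact_mod_cast this
  push_cast at this
  linarith

lemma aux_E_nonneg (k : ℕ) : 0 ≤ (k : ℝ) - ((k / 2 : ℕ) : ℝ) - ((k / 3 : ℕ) : ℝ)
    - ((k / 5 : ℕ) : ℝ) + ((k / 30 : ℕ) : ℝ) := by
  have : k / 2 + k / 3 + k / 5 ≤ k + k / 30 := by omega
  have : ((k / 2 + k / 3 + k / 5 : ℕ) : ℝ) ≤ ((k + k / 30 : ℕ) : ℝ) := by exact_mod_cast this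
  push_cast at this
  linarith

lemma aux_E_one (k : ℕ) (h1 : 1 ≤ k) (h2 : k < 6) :
    1 ≤ (k : ℝ) - ((k / 2 : ℕ) : ℝ) - ((k / 3 : ℕ) : ℝ)
    - ((k / 5 : ℕ) : ℝ) + ((k / 30 : ℕ) : ℝ) := by
  have : 1 + k / 2 + k / 3 + k / 5 ≤ k + k / 30 := by omega
  have : ((1 + k / 2 + k / 3 + k / 5 : ℕ) : ℝ) ≤ ((k + k / 30 : ℕ) : ℝ) := by exact_mod_cast this
  push_cast at this
  linarith

open ArithmeticFunction Finset in
lemma auxC_le_psi (M : ℕ) : auxC M ≤ Chebyshev.psi ((30 * M : ℕ) : ℝ) := by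
  rw [auxC_eq, Chebyshev.psi, Nat.floor_natCast]
  refine sum_le_sum fun d _ => ?_
  exact mul_le_of_le_one_right vonMangoldt_nonneg (aux_E_le _)

open ArithmeticFunction Finset in
lemma aux_psi_le (M : ℕ) :
    Chebyshev.psi ((30 * M : ℕ) : ℝ) ≤ auxC M + Chebyshev.psi ((5 * M : ℕ) : ℝ) := by
  rw [auxC_eq, Chebyshev.psi, Chebyshev.psi, Nat.floor_natCast, Nat.floor_natCast]
  have h1 : Ioc 0 (5 * M) = (Ioc 0 (30 * M)).filter (fun d => d ≤ 5 * M) := by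
    ext d
    simp only [mem_filter, mem_Ioc]
    omega
  rw [h1, sum_filter, ← sum_add_distrib]
  refine sum_le_sum fun d hd => ?_
  have hL : 0 ≤ vonMangoldt d := vonMangoldt_nonneg
  rw [mem_Ioc] at hd
  split_ifs with h
  · have := mul_nonneg hL (aux_E_nonneg (30 * M / d))
    linarith
  · have h2 : 1 ≤ 30 * M / d := (Nat.one_le_div_iff hd.1).2 hd.2
    have h3 : 30 * M / d < 6 := by
      rw [Nat.div_lt_iff_lt_mul hd.1]
      omega
    have := mul_le_mul_of_nonneg_left (aux_E_one _ h2 h3) hL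
    linarith

lemma aux_stirling (N : ℕ) (hN : 0 < N) :
    Real.log (N.factorial : ℝ) ≤ N * Real.log N - N + 1 / 2 * Real.log N + 1 ∧
    N * Real.log N - N + 1 / 2 * Real.log N + 11 / 12 ≤ Real.log (N.factorial : ℝ) := by
  obtain ⟨k, rfl⟩ : ∃ k, N = k + 1 := ⟨N - 1, by omega⟩
  have h1 := Stirling.log_stirlingSeq_formula (k + 1)
  have h2 := Stirling.log_stirlingSeq_bounded_by_constant k
  have h3 : Real.log (Stirling.stirlingSeq (k + 1)) ≤ Real.log (Stirling.stirlingSeq 1) :=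
    Stirling.log_stirlingSeq'_antitone (Nat.zero_le k)
  have hp : (0 : ℝ) < ((k + 1 : ℕ) : ℝ) := by positivity
  rw [Stirling.stirlingSeq_one, Real.log_div (by positivity) (by positivity), Real.log_exp,
    Real.log_sqrt (by norm_num)] at h3
  rw [Real.log_mul (by norm_num) hp.ne', Real.log_div hp.ne' (by positivity), Real.log_exp] at h1
  constructor <;> nlinarith

set_option exponentiation.threshold 500 in
lemma aux_const : 27.6268 < 14 * Real.log 2 + 9 * Real.log 3 + 5 * Real.log 5 ∧
    14 * Real.log 2 + 9 * Real.log 3 + 5 * Real.log 5 < 27.6393 := by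
  have e : 14 * Real.log 2 + 9 * Real.log 3 + 5 * Real.log 5
      = Real.log ((2:ℝ) ^ 14 * 3 ^ 9 * 5 ^ 5) := by
    rw [Real.log_mul (by norm_num) (by norm_num), Real.log_mul (by norm_num) (by norm_num),
      Real.log_pow, Real.log_pow, Real.log_pow]
    norm_num
  rw [e]
  have l1 := Real.log_two_gt_d9
  have l2 := Real.log_two_lt_d9
  have h1 : Real.log ((2:ℝ) ^ 279) ≤ Real.log (((2:ℝ) ^ 14 * 3 ^ 9 * 5 ^ 5) ^ 7) :=
    Real.log_le_log (by norm_num) (by norm_num)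
  have h2 : Real.log (((2:ℝ) ^ 14 * 3 ^ 9 * 5 ^ 5) ^ 8) ≤ Real.log ((2:ℝ) ^ 319) :=
    Real.log_le_log (by norm_num) (by norm_num)
  rw [Real.log_pow, Real.log_pow] at h1 h2
  push_cast at h1 h2
  generalize Real.log ((2:ℝ) ^ 14 * 3 ^ 9 * 5 ^ 5) = y at h1 h2 ⊢
  constructor <;> linarith

lemma auxC_bounds (M : ℕ) (hM : 0 < M) :
    27.6268 * (M : ℝ) - 1 / 2 * Real.log (60 * M) - 2 ≤ auxC M ∧ auxC M ≤ 27.6393 * (M : ℝ) := by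
  have hp : (0 : ℝ) < M := by exact_mod_cast hM
  obtain ⟨a1, b1⟩ := aux_stirling (30 * M) (by omega)
  obtain ⟨a2, b2⟩ := aux_stirling (15 * M) (by omega)
  obtain ⟨a3, b3⟩ := aux_stirling (10 * M) (by omega)
  obtain ⟨a4, b4⟩ := aux_stirling (6 * M) (by omega)
  obtain ⟨a5, b5⟩ := aux_stirling M hM
  have e30 : Real.log 30 = Real.log 2 + Real.log 3 + Real.log 5 := by
    rw [← Real.log_mul (by norm_num) (by norm_num), ← Real.log_mul (by norm_num) (by norm_num)]
    norm_num
  have e15 : Real.log 15 = Real.log 3 + Real.log 5 := by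
    rw [← Real.log_mul (by norm_num) (by norm_num)]
    norm_num
  have e10 : Real.log 10 = Real.log 2 + Real.log 5 := by
    rw [← Real.log_mul (by norm_num) (by norm_num)]
    norm_num
  have e6 : Real.log 6 = Real.log 2 + Real.log 3 := by
    rw [← Real.log_mul (by norm_num) (by norm_num)]
    norm_num
  have e60 : Real.log 60 = 2 * Real.log 2 + Real.log 3 + Real.log 5 := by
    rw [show (60 : ℝ) = 2 * 30 by norm_num, Real.log_mul (by norm_num) (by norm_num), e30]
    ring
  push_cast at *
  rw [Real.log_mul (by norm_num) hp.ne'] at a1 a2 a3 a4 b1 b2 b3 b4 ⊢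
  rw [e30] at a1 b1
  rw [e15] at a2 b2
  rw [e10] at a3 b3
  rw [e6] at a4 b4
  rw [e60]
  obtain ⟨c1, c2⟩ := aux_const
  have c1 := mul_le_mul_of_nonneg_right c1.le hp.le
  have c2 := mul_le_mul_of_nonneg_right c2.le hp.le
  have l2 : 0 < Real.log 2 := Real.log_pos (by norm_num)
  have l3 : 0 < Real.log 3 := Real.log_pos (by norm_num)
  have l5 : 0 < Real.log 5 := Real.log_pos (by norm_num)
  have lM : 0 ≤ Real.log M := Real.log_nonneg (by exact_mod_cast hM)
  have l2 := Real.log_two_gt_d9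
  have l4 : Real.log 2 ≤ Real.log 3 := Real.log_le_log (by norm_num) (by norm_num)
  have l6 : Real.log 2 ≤ Real.log 5 := Real.log_le_log (by norm_num) (by norm_num)
  unfold auxC
  constructor <;> linarith

lemma aux_psi_upper (N : ℕ) : Chebyshev.psi (N : ℝ) ≤ 1.13 * N + 9000 := by
  induction N using Nat.strong_induction_on with
  | _ N ih =>
    have l2 := Real.log_two_lt_d9
    by_cases hN : N < 1680
    · have h1 := Chebyshev.psi_le_const_mul_self (x := (N : ℝ)) (by positivity)
      have h4 : Real.log 4 = 2 * Real.log 2 := by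
        rw [show (4 : ℝ) = 2 ^ 2 by norm_num, Real.log_pow]
        norm_num
      rw [h4] at h1
      have h5 : (N : ℝ) < 1680 := by exact_mod_cast hN
      have h6 : (0 : ℝ) ≤ N := by positivity
      nlinarith
    · have h1 : Chebyshev.psi (N : ℝ) ≤ Chebyshev.psi ((30 * (N / 30 + 1) : ℕ) : ℝ) :=
        Chebyshev.psi_mono (by exact_mod_cast (by omega : N ≤ 30 * (N / 30 + 1)))
      have h2 := aux_psi_le (N / 30 + 1)
      have h3 := (auxC_bounds (N / 30 + 1) (by omega)).2
      have h4 := ih (5 * (N / 30 + 1)) (by omega)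
      have h5 : ((30 * (N / 30 + 1) : ℕ) : ℝ) ≤ ((N + 30 : ℕ) : ℝ) := by
        exact_mod_cast (by omega : 30 * (N / 30 + 1) ≤ N + 30)
      have h6 : (1680 : ℝ) ≤ N := by exact_mod_cast (by omega : 1680 ≤ N)
      push_cast at *
      linarith

open Finset in
lemma aux_prime_large (n : ℕ) (hn : 262144 ≤ n) :
    ∃ s : ℕ, s.Prime ∧ 3 * n < 2 * s ∧ s < 2 * n := by
  by_contra! hc
  have hnR : (262144 : ℝ) ≤ n := by exact_mod_cast hn
  have hth : Chebyshev.theta ((2 * n : ℕ) : ℝ) ≤ Chebyshev.theta ((3 * n / 2 : ℕ) : ℝ) := by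
    rw [Chebyshev.theta, Chebyshev.theta, Nat.floor_natCast, Nat.floor_natCast]
    refine sum_le_sum_of_subset_of_nonneg ?_ fun i _ _ => Real.log_natCast_nonneg i
    intro p hp
    simp only [mem_filter, mem_Ioc] at hp ⊢
    refine ⟨⟨hp.1.1, ?_⟩, hp.2⟩
    by_contra h1
    have h2 := hc p hp.2 (by omega)
    have h3 : p = 2 * n := by omega
    have := hp.2
    rw [h3] at this
    exact Nat.not_prime_mul (by norm_num) (by omega) this
  have h1 := Chebyshev.psi_sub_theta_le (x := ((2 * n : ℕ) : ℝ))
    (by exact_mod_cast (by omega : 1 ≤ 2 * n))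
  have h2 := Chebyshev.theta_le_psi ((3 * n / 2 : ℕ) : ℝ)
  have h3 := aux_psi_upper (3 * n / 2)
  have h4 : Chebyshev.psi ((30 * (2 * n / 30) : ℕ) : ℝ) ≤ Chebyshev.psi ((2 * n : ℕ) : ℝ) :=
    Chebyshev.psi_mono (by exact_mod_cast (by omega : 30 * (2 * n / 30) ≤ 2 * n))
  have h5 := auxC_le_psi (2 * n / 30)
  have h6 := (auxC_bounds (2 * n / 30) (by omega)).1
  have h7 : ((2 * n : ℕ) : ℝ) ≤ ((30 * (2 * n / 30) + 30 : ℕ) : ℝ) := by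
    exact_mod_cast (by omega : 2 * n ≤ 30 * (2 * n / 30) + 30)
  have h8 : ((2 * (3 * n / 2) : ℕ) : ℝ) ≤ ((3 * n : ℕ) : ℝ) := by
    exact_mod_cast (by omega : 2 * (3 * n / 2) ≤ 3 * n)
  have h9 : Real.log (60 * ((2 * n / 30 : ℕ) : ℝ)) ≤ 60 * ((2 * n / 30 : ℕ) : ℝ) / 1024 + 7 := by
    have hpos : (0 : ℝ) < ((2 * n / 30 : ℕ) : ℝ) := by
      exact_mod_cast (by omega : 0 < 2 * n / 30)
    have a1 := Real.log_le_sub_one_of_pos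
      (show 0 < 60 * ((2 * n / 30 : ℕ) : ℝ) / 1024 by positivity)
    rw [Real.log_div (by positivity) (by norm_num), show (1024 : ℝ) = 2 ^ 10 by norm_num,
      Real.log_pow] at a1
    have := Real.log_two_lt_d9
    push_cast at a1 this ⊢
    norm_num at a1 this ⊢
    linarith
  have h10 : ((30 * (2 * n / 30) : ℕ) : ℝ) ≤ ((2 * n : ℕ) : ℝ) := by
    exact_mod_cast (by omega : 30 * (2 * n / 30) ≤ 2 * n)
  obtain ⟨t, ht⟩ : ∃ t, t = √((2 * n : ℕ) : ℝ) := ⟨_, rfl⟩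
  have ht2 : t * t = 2 * n := by
    rw [ht, Real.mul_self_sqrt (by positivity)]
    push_cast
    rfl
  have ht3 : 724 ≤ t := by
    rw [ht]
    apply Real.le_sqrt_of_sq_le
    push_cast
    linarith
  have hlog : Real.log ((2 * n : ℕ) : ℝ) ≤ 2 * (5.932 + t / 1024) := by
    have e : ((2 * n : ℕ) : ℝ) = t ^ 2 := by
      push_cast
      rw [← ht2]
      ring
    rw [e, Real.log_pow]
    have a1 := Real.log_le_sub_one_of_pos (show 0 < t / 1024 by positivity)
    rw [Real.log_div (by positivity) (by norm_num),
      show Real.log (1024 : ℝ) = 10 * Real.log 2 by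
        rw [show (1024 : ℝ) = 2 ^ 10 by norm_num, Real.log_pow]; norm_num] at a1
    have := Real.log_two_lt_d9
    push_cast
    linarith
  rw [← ht] at h1
  have h11 : 2 * t * Real.log ((2 * n : ℕ) : ℝ) ≤ 2 * t * (2 * (5.932 + t / 1024)) :=
    mul_le_mul_of_nonneg_left hlog (by linarith)
  have h12 : 724 * t ≤ 2 * n := by nlinarith
  have h13 : 2 * t * (2 * (5.932 + t / 1024)) = 23.728 * t + 2 * n / 256 := by
    rw [← ht2]
    ring
  push_cast at *
  linarith

lemma aux_prime (n : ℕ) (hn : 29 ≤ n) : ∃ s : ℕ, s.Prime ∧ 3 * n < 2 * s ∧ s < 2 * n := by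
  by_cases h53 : 3 * n < 2 * 53
  · exact ⟨53, by norm_num, by omega, by omega⟩
  by_cases h71 : 3 * n < 2 * 71
  · exact ⟨71, by norm_num, by omega, by omega⟩
  by_cases h89 : 3 * n < 2 * 89
  · exact ⟨89, by norm_num, by omega, by omega⟩
  by_cases h113 : 3 * n < 2 * 113
  · exact ⟨113, by norm_num, by omega, by omega⟩
  by_cases h151 : 3 * n < 2 * 151
  · exact ⟨151, by norm_num, by omega, by omega⟩
  by_cases h199 : 3 * n < 2 * 199
  · exact ⟨199, by norm_num, by omega, by omega⟩
  by_cases h263 : 3 * n < 2 * 263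
  · exact ⟨263, by norm_num, by omega, by omega⟩
  by_cases h349 : 3 * n < 2 * 349
  · exact ⟨349, by norm_num, by omega, by omega⟩
  by_cases h463 : 3 * n < 2 * 463
  · exact ⟨463, by norm_num, by omega, by omega⟩
  by_cases h617 : 3 * n < 2 * 617
  · exact ⟨617, by norm_num, by omega, by omega⟩
  by_cases h823 : 3 * n < 2 * 823
  · exact ⟨823, by norm_num, by omega, by omega⟩
  by_cases h1097 : 3 * n < 2 * 1097
  · exact ⟨1097, by norm_num, by omega, by omega⟩
  by_cases h1459 : 3 * n < 2 * 1459
  · exact ⟨1459, by norm_num, by omega, by omega⟩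
  by_cases h1933 : 3 * n < 2 * 1933
  · exact ⟨1933, by norm_num, by omega, by omega⟩
  by_cases h2557 : 3 * n < 2 * 2557
  · exact ⟨2557, by norm_num, by omega, by omega⟩
  by_cases h3407 : 3 * n < 2 * 3407
  · exact ⟨3407, by norm_num, by omega, by omega⟩
  by_cases h4523 : 3 * n < 2 * 4523
  · exact ⟨4523, by norm_num, by omega, by omega⟩
  by_cases h6029 : 3 * n < 2 * 6029
  · exact ⟨6029, by norm_num, by omega, by omega⟩
  by_cases h8039 : 3 * n < 2 * 8039
  · exact ⟨8039, by norm_num, by omega, by omega⟩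
  by_cases h10711 : 3 * n < 2 * 10711
  · exact ⟨10711, by norm_num, by omega, by omega⟩
  by_cases h14281 : 3 * n < 2 * 14281
  · exact ⟨14281, by norm_num, by omega, by omega⟩
  by_cases h19037 : 3 * n < 2 * 19037
  · exact ⟨19037, by norm_num, by omega, by omega⟩
  by_cases h25373 : 3 * n < 2 * 25373
  · exact ⟨25373, by norm_num, by omega, by omega⟩
  by_cases h33829 : 3 * n < 2 * 33829
  · exact ⟨33829, by norm_num, by omega, by omega⟩
  by_cases h45083 : 3 * n < 2 * 45083
  · exact ⟨45083, by norm_num, by omega, by omega⟩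
  by_cases h60107 : 3 * n < 2 * 60107
  · exact ⟨60107, by norm_num, by omega, by omega⟩
  by_cases h80141 : 3 * n < 2 * 80141
  · exact ⟨80141, by norm_num, by omega, by omega⟩
  by_cases h106853 : 3 * n < 2 * 106853
  · exact ⟨106853, by norm_num, by omega, by omega⟩
  by_cases h142469 : 3 * n < 2 * 142469
  · exact ⟨142469, by norm_num, by omega, by omega⟩
  by_cases h189949 : 3 * n < 2 * 189949
  · exact ⟨189949, by norm_num, by omega, by omega⟩
  by_cases h253247 : 3 * n < 2 * 253247
  · exact ⟨253247, by norm_num, by omega, by omega⟩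
  by_cases h337661 : 3 * n < 2 * 337661
  · exact ⟨337661, by norm_num, by omega, by omega⟩
  by_cases h450209 : 3 * n < 2 * 450209
  · exact ⟨450209, by norm_num, by omega, by omega⟩
  exact aux_prime_large n (by omega)

theorem exists_pow_and_prime (m : ℕ) (hm : 0 < m) (n : ℕ) (hn : 0 < n)
    (h : (n : ℝ) > 14.4 / ((1.5 : ℝ) ^ ((1 : ℝ) / (m : ℝ)) - 1) ^ m) :
    ∃ (a : ℕ) (s : ℕ), 0 < a ∧ s.Prime ∧
      2 * n < 2 * a ^ m ∧ 2 * a ^ m < 3 * n ∧ 3 * n < 2 * s ∧ 2 * s < 4 * n := by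
  have hm0 : m ≠ 0 := by omega
  obtain ⟨c, hc⟩ : ∃ c, c = (1.5 : ℝ) ^ ((1 : ℝ) / (m : ℝ)) := ⟨_, rfl⟩
  obtain ⟨x, hx⟩ : ∃ x, x = (n : ℝ) ^ ((1 : ℝ) / (m : ℝ)) := ⟨_, rfl⟩
  have hmp : (0 : ℝ) < 1 / (m : ℝ) := by positivity
  have hm1 : (1 : ℝ) ≤ m := by exact_mod_cast hm
  have hc1 : 1 < c := by
    rw [hc]
    exact Real.one_lt_rpow (by norm_num) hmp
  have hcm : c ^ m = 1.5 := by
    rw [hc, one_div]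
    exact Real.rpow_inv_natCast_pow (by norm_num) hm0
  have hxm : x ^ m = n := by
    rw [hx, one_div]
    exact Real.rpow_inv_natCast_pow (by positivity) hm0
  have hx0 : 0 < x := by
    rw [hx]
    positivity
  rw [← hc] at h
  have hd : 0 < (c - 1) ^ m := pow_pos (by linarith) m
  have hn' : 14.4 < n * (c - 1) ^ m := by
    rwa [gt_iff_lt, div_lt_iff₀ hd] at h
  have hc2 : c ≤ 1.5 := by
    rw [← hcm]
    exact le_self_pow₀ hc1.le hm0
  have hd2 : (c - 1) ^ m ≤ 0.5 := by
    have : (c - 1) ^ m ≤ c - 1 := pow_le_of_le_one (by linarith) (by linarith) hm0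
    linarith
  have hn29 : 29 ≤ n := by
    have h1 : (28 : ℝ) < n := by
      have : (0 : ℝ) < n := by exact_mod_cast hn
      nlinarith
    have : 28 < n := by exact_mod_cast h1
    omega
  have hlen : 1 < x * (c - 1) := by
    by_contra! hle
    have h1 : (x * (c - 1)) ^ m ≤ 1 := pow_le_one₀ (by nlinarith) hle
    rw [mul_pow, hxm] at h1
    linarith
  obtain ⟨s, hs, hs1, hs2⟩ := aux_prime n hn29
  have ha1 : x < ((⌊x⌋₊ + 1 : ℕ) : ℝ) := by
    push_cast
    exact Nat.lt_floor_add_one x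
  have ha2 : ((⌊x⌋₊ + 1 : ℕ) : ℝ) < x * c := by
    push_cast
    have := Nat.floor_le hx0.le
    linarith
  have p1 : (n : ℝ) < ((⌊x⌋₊ + 1 : ℕ) : ℝ) ^ m := by
    rw [← hxm]
    exact pow_lt_pow_left₀ ha1 hx0.le hm0
  have p2 : ((⌊x⌋₊ + 1 : ℕ) : ℝ) ^ m < n * 1.5 := by
    rw [← hxm, ← hcm, ← mul_pow]
    exact pow_lt_pow_left₀ ha2 (by positivity) hm0
  refine ⟨⌊x⌋₊ + 1, s, by omega, hs, ?_, ?_, hs1, by omega⟩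
  · have : n < (⌊x⌋₊ + 1) ^ m := by exact_mod_cast p1
    omega
  · have : (2 : ℝ) * ((⌊x⌋₊ + 1 : ℕ) : ℝ) ^ m < 3 * n := by linarith
    exact_mod_cast this
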